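/- Define f_A and f_J on the set {0,1,2,3,4,5,6,7} by f_A(0)=0, f_A(1)=0, f_A(2)=1, f_A(3)=1, f_A(4)=2, f_A(5)=2, f_A(6)=3, f_A(7)=3, and f_J(0)=0, f_J(1)=0, f_J(2)=1, f_J(3)=2, f_J(4)=3, f_J(5)=3, f_J(6)=2, f_J(7)=1. Then for every permutation σ of the 16-element set W_2^4 satisfying the diagonal condition, each of the two functions f_1^σ and f_2^σ (viewed as functions on the 8-element set W_2^3 after fixing any bijection W_2^3 ≅ {0,…,7}) is conjugate, via a bijection, to f_A or to f_J; moreover it is not the case that both f_1^σ and f_2^σ are conjugate to f_J. -/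

import Mathlib

/-- For a permutation `σ` of words of length `k+1` over the alphabet `Fin n`, and a letter `i`,
`fword σ i α` is the word `β` of length `k` such that `σ (β.m) = i.α` for some letter `m`,
i.e. the first `k` letters of `σ⁻¹ (i.α)`.  (The map `f_i^σ` of the paper.) -/
def fword {n k : ℕ} (σ : Equiv.Perm (Fin (k + 1) → Fin n)) (i : Fin n)
    (α : Fin k → Fin n) : Fin k → Fin n :=
  Fin.init (σ.symm (Fin.cons i α))

/-- The sets `Σ_m` associated to a family of maps `f_i : X → X`. -/
def SigmaSet {X : Type*} {n : ℕ} (f : Fin n → X → X) : ℕ → Set (X × X)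
  | 0 => {p | p.1 = p.2}
  | m + 1 => SigmaSet f m ∪ {p | ∀ i, (f i p.1, f i p.2) ∈ SigmaSet f m}

/-- The diagonal condition: `⋃ m, Σ_m = X × X` for the family `f_i^σ`. -/
def diagCond {n k : ℕ} (σ : Equiv.Perm (Fin (k + 1) → Fin n)) : Prop :=
  (⋃ m, SigmaSet (fword σ) m) = Set.univ

/-- The set `𝒲`: off-diagonal pairs of words of length `k`, together with a point `†` (`none`). -/
def OffDiag (n k : ℕ) := Option {q : (Fin k → Fin n) × (Fin k → Fin n) // q.1 ≠ q.2}

/-- The map `f_{ij}^σ` on `𝒲`: it sends `(α,β)` to `(γ,δ)` if `σ(γm) = iα` and `σ(δm) = jβ`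
for some letter `m`, and to `†` otherwise; `†` is fixed. -/
def fpair {n k : ℕ} (σ : Equiv.Perm (Fin (k + 1) → Fin n)) (i j : Fin n) :
    OffDiag n k → OffDiag n k
  | none => none
  | some ⟨(α, β), _⟩ =>
      if h : (σ.symm (Fin.cons i α)) (Fin.last k) = (σ.symm (Fin.cons j β)) (Fin.last k) ∧
          Fin.init (σ.symm (Fin.cons i α)) ≠ Fin.init (σ.symm (Fin.cons j β)) then
        some ⟨(Fin.init (σ.symm (Fin.cons i α)), Fin.init (σ.symm (Fin.cons j β))), h.2⟩
      else none

/-- The sets `Ψ_m` associated to a family of maps `g_j : Y → Y` and a point `†`. -/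
def PsiSet {Y ι : Type*} (dag : Y) (g : ι → Y → Y) : ℕ → Set Y
  | 0 => {dag}
  | m + 1 => {dag} ∪ {y | ∀ j, g j y ∈ PsiSet dag g m}

/-- The annihilation condition: `⋃ m, Ψ_m = 𝒲` for the family `f_{ij}^σ`. -/
def annCond {n k : ℕ} (σ : Equiv.Perm (Fin (k + 1) → Fin n)) : Prop :=
  (⋃ m, PsiSet (none : OffDiag n k) (fun ij : Fin n × Fin n => fpair σ ij.1 ij.2) m) = Set.univ

/-- The function encoding the rooted tree `T_A` (the full binary tree with a tail to the root). -/
def fA : Fin 8 → Fin 8 := ![0, 0, 1, 1, 2, 2, 3, 3]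

/-- The function encoding the rooted tree `T_J` (a path with three extra leaves). -/
def fJ : Fin 8 → Fin 8 := ![0, 0, 1, 2, 3, 3, 2, 1]

/-- `f` is conjugate to `g` via some bijection of its domain with `{0,…,7}`. -/
def ConjTo {X : Type*} (f : X → X) (g : Fin 8 → Fin 8) : Prop :=
  ∃ e : X ≃ Fin 8, ∀ x, e (f x) = g (e x)

namespace Stmt18

/-- `E f m x y`: all words of length `m` in the maps `f i` send `x` and `y` to the same point. -/
def E {X : Type} (f : Fin 2 → X → X) : ℕ → X → X → Prop
  | 0, x, y => x = y
  | m + 1, x, y => ∀ i, E f m (f i x) (f i y)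

/-- Apply the word `w` to `x`. -/
def run {X : Type} (f : Fin 2 → X → X) : List (Fin 2) → X → X
  | [], x => x
  | i :: w, x => run f w (f i x)

variable {X : Type} {f : Fin 2 → X → X}

theorem E_refl (m : ℕ) (x : X) : E f m x x := by
  induction m generalizing x with
  | zero => rfl
  | succ m ih => exact fun i => ih _

theorem E_symm (m : ℕ) (x y : X) (h : E f m x y) : E f m y x := by
  induction m generalizing x y with
  | zero => exact Eq.symm h
  | succ m ih => exact fun i => ih _ _ (h i)

theorem E_trans (m : ℕ) (x y z : X) (h : E f m x y) (h' : E f m y z) : E f m x z := by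
  induction m generalizing x y z with
  | zero => exact Eq.trans h h'
  | succ m ih => exact fun i => ih _ _ _ (h i) (h' i)

theorem E_succ (m : ℕ) (x y : X) (h : E f m x y) : E f (m + 1) x y := by
  induction m generalizing x y with
  | zero => intro i; cases h; rfl
  | succ m ih => exact fun i => ih _ _ (h i)

theorem E_mono {m n : ℕ} (hmn : m ≤ n) (x y : X) (h : E f m x y) : E f n x y := by
  induction hmn with
  | refl => exact h
  | step _ ih => exact E_succ _ _ _ ih

theorem E_of_sigma (m : ℕ) (x y : X) (h : (x, y) ∈ SigmaSet f m) : E f m x y := by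
  induction m generalizing x y with
  | zero => exact h
  | succ m ih =>
    rcases h with h | h
    · exact E_succ _ _ _ (ih _ _ h)
    · exact fun i => ih _ _ (h i)

theorem E_run (m : ℕ) (w : List (Fin 2)) (x y : X) (h : E f m x y) :
    E f (m - w.length) (run f w x) (run f w y) := by
  induction w generalizing m x y with
  | nil => exact h
  | cons i w ih =>
    cases m with
    | zero => cases h; exact E_refl _ _
    | succ m =>
      have := ih m _ _ (h i)
      simpa [run] using this

/-- Under the diagonal condition every nonempty word has at most one fixed point. -/
theorem fix_unique (N : ℕ) (w : List (Fin 2)) (hw : w ≠ []) (x y : X)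
    (h : E f N x y) (hx : run f w x = x) (hy : run f w y = y) : x = y := by
  induction N using Nat.strong_induction_on with
  | _ N ih =>
    rcases Nat.eq_zero_or_pos N with h0 | h0
    · subst h0; exact h
    · have h1 := E_run N w x y h
      rw [hx, hy] at h1
      have : 0 < w.length := List.length_pos_iff.2 hw
      exact ih _ (by omega) h1

/-- Each point is hit exactly twice by the two maps together. -/
def Deg (f : Fin 2 → X → X) : Prop :=
  ∀ b, ∃ p q : Fin 2 × X, p ≠ q ∧ ∀ i x, f i x = b ↔ (i, x) = p ∨ (i, x) = q

theorem disj (hd : Deg f) (N : ℕ) (hN : ∀ x y, E f N x y) (x0 y0 : X) (hne : x0 ≠ y0)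
    (a b : X) : f 0 a ≠ f 1 b := by
  classical
  intro hab
  have hex : ∃ N, ∀ x y, E f N x y := ⟨N, hN⟩
  have h1 := Nat.find_spec hex
  have h2 := fun m => @Nat.find_min _ _ hex m
  set M := Nat.find hex
  rcases hM : M with _ | m
  · rw [hM] at h1; exact hne (h1 x0 y0)
  · apply h2 m (by omega)
    rw [hM] at h1
    have key : ∀ i x, E f m (f i x) (f 0 a) := by
      intro i x
      fin_cases i
      · exact h1 x a 0
      · have := h1 x b 1
        rw [← hab] at this
        exact this
    have hs : ∀ z, ∃ i x, f i x = z := by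
      intro z
      obtain ⟨p, q, -, h⟩ := hd z
      exact ⟨p.1, p.2, (h _ _).2 (Or.inl rfl)⟩
    intro x y
    obtain ⟨i, u, rfl⟩ := hs x
    obtain ⟨j, v, rfl⟩ := hs y
    exact E_trans _ _ _ _ (key i u) (E_symm _ _ _ (key j v))

/-- A tree all of whose in-degrees are `0` or `2`, with eight vertices, is `T_A` or `T_J`. -/
theorem tree_class [Fintype X] [DecidableEq X] (hc : Fintype.card X = 8) (g : X → X) (N : ℕ)
    (hN : ∀ x y, g^[N] x = g^[N] y)
    (hg : ∀ z, ∃ a b, a ≠ b ∧ ∀ x, g x = g z ↔ x = a ∨ x = b) :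
    ConjTo g fA ∨ ConjTo g fJ := by
  have hne : Nonempty X := by
    rw [← Fintype.card_pos_iff]; omega
  obtain ⟨x0⟩ := hne
  obtain ⟨r, hr⟩ : ∃ r, g r = r := by
    refine ⟨g^[N] x0, ?_⟩
    rw [← Function.iterate_succ_apply' g, Function.iterate_succ_apply]
    exact hN _ _
  have hclosed : ∀ S : Finset X, r ∈ S → (∀ x, g x ∈ S → x ∈ S) → 8 ≤ S.card := by
    intro S hrS hS
    have hit : ∀ n x, g^[n] x ∈ S → x ∈ S := by
      intro n
      induction n with
      | zero => intro x h; exact h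
      | succ n ih => intro x h; exact hS x (ih _ h)
    have : S = Finset.univ := by
      ext x
      simp only [Finset.mem_univ, iff_true]
      apply hit N
      rw [hN x r, Function.iterate_fixed hr]
      exact hrS
    rw [this, Finset.card_univ, hc]
  have mk : ∀ (t : Fin 8 → Fin 8) (φ : Fin 8 → X), Function.Injective φ →
      (∀ k, g (φ k) = φ (t k)) → ConjTo g t := by
    intro t φ hφ h
    have hb : Function.Bijective φ := by
      rw [Fintype.bijective_iff_injective_and_card]
      exact ⟨hφ, by simp [hc]⟩
    refine ⟨(Equiv.ofBijective φ hb).symm, fun x => ?_⟩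
    obtain ⟨k, rfl⟩ := hb.2 x
    rw [h k]
    have : ∀ k, (Equiv.ofBijective φ hb).symm (φ k) = k := fun k =>
      (Equiv.ofBijective φ hb).symm_apply_apply k
    rw [this, this]
  -- preimages of an image point
  have pre : ∀ y z, g z = y → ∃ a b, a ≠ b ∧ g a = y ∧ g b = y ∧ ∀ x, g x = y → x = a ∨ x = b := by
    rintro y z rfl
    obtain ⟨a, b, hab, h⟩ := hg z
    exact ⟨a, b, hab, (h a).2 (Or.inl rfl), (h b).2 (Or.inr rfl), fun x => (h x).1⟩
  obtain ⟨a, har, ha, hpr⟩ : ∃ a, a ≠ r ∧ g a = r ∧ ∀ x, g x = r → x = r ∨ x = a := by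
    obtain ⟨a, b, hab, h1, h2, h⟩ := pre r r hr
    rcases h r hr with e | e
    · subst e; exact ⟨b, hab.symm, h2, h⟩
    · subst e; exact ⟨a, hab, h1, fun x hx => (h x hx).symm⟩
  obtain ⟨z, hz⟩ : ∃ z, g z = a := by
    by_contra hcon
    push Not at hcon
    have := hclosed {r, a} (by simp) (by
      intro x hx
      simp only [Finset.mem_insert, Finset.mem_singleton] at hx ⊢
      rcases hx with hx | hx
      · exact hpr x hx
      · exact absurd hx (hcon x))
    have h2 := Finset.card_le_two (a := r) (b := a)
    omega
  obtain ⟨b, c, hbc, hb, hcc, hpa, z, hz⟩ : ∃ b c, b ≠ c ∧ g b = a ∧ g c = a ∧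
      (∀ x, g x = a → x = b ∨ x = c) ∧ ∃ z, g z = b := by
    obtain ⟨b, c, hbc, hb, hcc, h⟩ := pre a z hz
    by_cases h1 : ∃ z, g z = b
    · exact ⟨b, c, hbc, hb, hcc, h, h1⟩
    by_cases h2 : ∃ z, g z = c
    · exact ⟨c, b, hbc.symm, hcc, hb, fun x hx => (h x hx).symm, h2⟩
    exfalso
    push Not at h1 h2
    have := hclosed {r, a, b, c} (by simp) (by
      intro x hx
      simp only [Finset.mem_insert, Finset.mem_singleton] at hx ⊢
      rcases hx with hx | hx | hx | hx
      · have := hpr x hx; tauto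
      · have := h x hx; tauto
      · exact absurd hx (h1 x)
      · exact absurd hx (h2 x))
    have h2 := Finset.card_le_four (a := r) (b := a) (c := b) (d := c)
    omega
  have e1 : b ≠ r := by grind
  have e2 : b ≠ a := by grind
  have e3 : c ≠ r := by grind
  have e4 : c ≠ a := by grind
  by_cases hcz : ∃ z, g z = c
  · obtain ⟨d, e, hde, hd, he, hpb⟩ := pre b z hz
    obtain ⟨y, hy⟩ := hcz
    obtain ⟨u, v, huv, hu, hv, hpc⟩ := pre c y hy
    left
    apply mk fA [r, a, b, c, d, e, u, v].get
    · have : List.Nodup [r, a, b, c, d, e, u, v] := by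
        simp only [List.nodup_cons, List.mem_cons, List.not_mem_nil, not_or, or_false]
        refine ⟨⟨?_, ?_, ?_, ?_, ?_, ?_, ?_⟩, ⟨?_, ?_, ?_, ?_, ?_, ?_⟩, ⟨?_, ?_, ?_, ?_, ?_⟩,
          ⟨?_, ?_, ?_, ?_⟩, ⟨?_, ?_, ?_⟩, ⟨?_, ?_⟩, ?_, by simp⟩ <;> grind
      rw [List.nodup_iff_injective_get] at this
      exact this
    · intro k
      fin_cases k <;> simp [fA, *]
  · obtain ⟨d, e, hde, hd, he, hpb, y, hy⟩ : ∃ d e, d ≠ e ∧ g d = b ∧ g e = b ∧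
        (∀ x, g x = b → x = d ∨ x = e) ∧ ∃ z, g z = d := by
      obtain ⟨d, e, hde, hd, he, h⟩ := pre b z hz
      by_cases h1 : ∃ z, g z = d
      · exact ⟨d, e, hde, hd, he, h, h1⟩
      by_cases h2 : ∃ z, g z = e
      · exact ⟨e, d, hde.symm, he, hd, fun x hx => (h x hx).symm, h2⟩
      exfalso
      push Not at h1 h2 hcz
      have := hclosed {r, a, b, c, d, e} (by simp) (by
        intro x hx
        simp only [Finset.mem_insert, Finset.mem_singleton] at hx ⊢
        rcases hx with hx | hx | hx | hx | hx | hx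
        · have := hpr x hx; tauto
        · have := hpa x hx; tauto
        · have := h x hx; tauto
        · exact absurd hx (hcz x)
        · exact absurd hx (h1 x)
        · exact absurd hx (h2 x))
      have h2 := Finset.card_le_six (a := r) (b := a) (c := b) (d := c) (e := d) (f := e)
      omega
    obtain ⟨u, v, huv, hu, hv, hpd⟩ := pre d y hy
    push Not at hcz
    right
    apply mk fJ [r, a, b, d, u, v, e, c].get
    · have : List.Nodup [r, a, b, d, u, v, e, c] := by
        simp only [List.nodup_cons, List.mem_cons, List.not_mem_nil, not_or, or_false]
        have d1 : d ≠ r := by grind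
        have d2 : d ≠ a := by grind
        have d3 : d ≠ b := by grind
        have d4 : d ≠ c := by grind
        refine ⟨⟨?_, ?_, ?_, ?_, ?_, ?_, ?_⟩, ⟨?_, ?_, ?_, ?_, ?_, ?_⟩, ⟨?_, ?_, ?_, ?_, ?_⟩,
          ⟨?_, ?_, ?_, ?_⟩, ⟨?_, ?_, ?_⟩, ⟨?_, ?_⟩, ?_, by simp⟩ <;> grind
      rw [List.nodup_iff_injective_get] at this
      exact this
    · intro k
      fin_cases k <;> simp [fJ, *]

/-! ### The finite search excluding the pair `T_J`, `T_J` -/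

/-- Table lookup. -/
noncomputable def lk (l : List ℕ) : ℕ → ℕ :=
  List.rec (fun _ => 0) (fun a _ ih x => Nat.rec a (fun y _ => ih y) x) l

/-- One step: letter `false` is `fJ`, letter `true` is the function with value table `l`. -/
noncomputable def stp (l : List ℕ) (i : Bool) (x : ℕ) : ℕ :=
  match i with
  | false => lk [0, 0, 1, 2, 3, 3, 2, 1] x
  | true => lk l x

/-- The letter of `Fin 2` named by a Boolean. -/
def letter : Bool → Fin 2
  | false => 0
  | true => 1

/-- The word `w` fixes `x`. -/
noncomputable def fx (l : List ℕ) (w : List Bool) (x : ℕ) : Bool := (w.foldl (fun x i => stp l i x) x).beq x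

/-- The word `w` has two fixed points. -/
noncomputable def twoFix (l : List ℕ) (w : List Bool) : Bool :=
  [4, 5, 6, 7].any fun x => fx l w x && [4, 5, 6, 7].any fun y => Nat.blt y x && fx l w y

/-- The test applied to a complete table. -/
noncomputable def chk (l : List ℕ) : Bool :=
  ([0, 1, 2, 3, 4, 5, 6, 7].all fun x => (lk l (lk l (lk l x))).beq
    (lk l (lk l (lk l 0)))) ||
  (([[true],
    [true, true],
    [true, true, true],
    [false, true],
    [false, false, true],
    [false, true, true],
    [false, true, false, true],
    [false, false, true, false, false, true],
    [false, true, true, false, true, true],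
    [false, false, false, true, false, false, false, true],
    [false, false, true, true, false, false, true, true],
    [false, true, true, true, false, true, true, true]] :
    List (List Bool)).any fun w => twoFix l w)

/-- Number of occurrences, in a form that evaluates quickly. -/
def cnt (a : ℕ) : List ℕ → ℕ
  | [] => 0
  | b :: l => bif Nat.beq b a then Nat.succ (cnt a l) else cnt a l

theorem cnt_eq (a : ℕ) (l : List ℕ) : cnt a l = l.count a := by
  induction l with
  | nil => rfl
  | cons b l ih =>
    rw [cnt, ih, List.count_cons]
    by_cases h : b = a
    · subst h; simp
    · have h' : Nat.beq b a = false := by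
        rw [← Bool.not_eq_true, Nat.beq_eq]; exact h
      simp [h, h']

/-- Exhaustive search over the tables with values in `{4,5,6,7}`, each taken at most twice. -/
noncomputable def search : ℕ → List ℕ → Bool
  | 0, l => chk l
  | n + 1, l => [4, 5, 6, 7].all fun a => Nat.ble 2 (cnt a l) || search n (a :: l)

set_option maxRecDepth 100000 in
theorem search_true : search 8 [] = true := by decide +kernel

theorem search_sound (n : ℕ) (l l' : List ℕ) (hl : l'.length = n) (hs : search n l = true)
    (hv : ∀ a ∈ l', a ∈ [4, 5, 6, 7]) (hcnt : ∀ a, (l' ++ l).count a ≤ 2) :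
    chk (l' ++ l) = true := by
  induction n generalizing l l' with
  | zero =>
    have : l' = [] := List.length_eq_zero_iff.1 hl
    subst this; exact hs
  | succ n ih =>
    obtain ⟨l'', a, rfl⟩ : ∃ l'' a, l' = l'' ++ [a] :=
      ⟨l'.dropLast, l'.getLast (by rintro rfl; simp at hl), (List.dropLast_append_getLast _).symm⟩
    have hs' := List.all_eq_true.1 hs a (hv a (by simp))
    have e : l'' ++ [a] ++ l = l'' ++ a :: l := by simp
    rw [e] at hcnt ⊢
    apply ih
    · simpa using hl
    · have := hcnt a
      simp only [List.count_append, List.count_cons_self] at this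
      rcases Bool.or_eq_true_iff.1 hs' with h | h
      · have h3 := Nat.le_of_ble_eq_true h; rw [cnt_eq] at h3; omega
      · exact h
    · intro b hb; exact hv b (by simp [hb])
    · exact hcnt

theorem getD_table (G : Fin 8 → Fin 8) (x : Fin 8) :
    lk (List.ofFn fun k => (G k : ℕ)) x = G x := by
  fin_cases x <;> rfl

theorem run_table (F : Fin 2 → Fin 8 → Fin 8) (h0 : F 0 = fJ) (w : List Bool) (x : Fin 8) :
    w.foldl (fun x i => stp (List.ofFn fun k => (F 1 k : ℕ)) i x) (x : ℕ) =
      ((run F (w.map letter) x : Fin 8) : ℕ) := by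
  induction w generalizing x with
  | nil => rfl
  | cons i w ih =>
    have : stp (List.ofFn fun k => (F 1 k : ℕ)) i (x : ℕ) = (F (letter i) x : ℕ) := by
      cases i
      · show lk [0, 0, 1, 2, 3, 3, 2, 1] (x : ℕ) = (F 0 x : ℕ)
        rw [h0]; revert x; decide
      · exact getD_table _ _
    simp only [List.foldl_cons, List.map_cons, run]
    rw [this, ih]

theorem cube_const (F : Fin 2 → Fin 8 → Fin 8) (h0 : F 0 = fJ)
    (hfix : ∀ w ≠ [], ∀ x y, run F w x = x → run F w y = y → x = y)
    (hdisj : ∀ a b, F 0 a ≠ F 1 b) (hd : Deg F) (x : Fin 8) :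
    F 1 (F 1 (F 1 x)) = F 1 (F 1 (F 1 0)) := by
  have hchk := search_sound 8 [] (List.ofFn fun k => (F 1 k : ℕ)) (by simp) search_true (by
      intro a ha
      obtain ⟨k, rfl⟩ := (List.mem_ofFn' _ _).1 ha
      have h1 : ∀ v : Fin 8, (∀ a, fJ a ≠ v) → (v : ℕ) ∈ [4, 5, 6, 7] := by decide
      apply h1
      intro a; rw [← h0]; exact hdisj a k) (by
      intro a
      rw [List.append_nil, List.ofFn_eq_map, List.count, List.countP_map, List.countP_eq_length_filter]
      by_cases ha : a < 8
      · obtain ⟨p, q, -, h⟩ := hd ⟨a, ha⟩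
        rw [← List.toFinset_card_of_nodup ((List.nodup_finRange 8).filter _)]
        refine le_trans (Finset.card_le_card (t := {p.2, q.2}) ?_) Finset.card_le_two
        intro k hk
        simp only [List.mem_toFinset, List.mem_filter, List.mem_finRange, true_and,
          Function.comp, beq_iff_eq] at hk
        have := (h 1 k).1 (Fin.ext hk)
        simp only [Finset.mem_insert, Finset.mem_singleton]
        rcases this with h | h
        · left; rw [← h]
        · right; rw [← h]
      · rw [List.filter_eq_nil_iff.2]
        · simp
        · intro k _
          simp only [Function.comp, beq_iff_eq]
          have := (F 1 k).2
          omega)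
  rw [List.append_nil] at hchk
  set l := List.ofFn fun k => (F 1 k : ℕ) with hl
  rcases (Bool.or_eq_true_iff.1 hchk).symm with h | h
  · exfalso
    obtain ⟨w, hw, h⟩ := List.any_eq_true.1 h
    have hw' : w ≠ [] := by rintro rfl; revert hw; decide
    obtain ⟨a, ha, h⟩ := List.any_eq_true.1 h
    obtain ⟨h1, h⟩ := (Bool.and_eq_true_iff).1 h
    obtain ⟨b, hb, h2⟩ := List.any_eq_true.1 h
    obtain ⟨hb, h2⟩ := (Bool.and_eq_true_iff).1 h2
    replace hb : b < a := Nat.le_of_ble_eq_true hb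
    have ha : a < 8 := by simp at ha; omega
    have h1' := Nat.eq_of_beq_eq_true h1
    have h2' := Nat.eq_of_beq_eq_true h2
    have e1 := run_table F h0 w ⟨a, ha⟩
    have e2 := run_table F h0 w ⟨b, by omega⟩
    have := hfix (w.map letter) (by simpa using hw') ⟨a, ha⟩ ⟨b, by omega⟩ (Fin.ext (e1.symm.trans h1'))
      (Fin.ext (e2.symm.trans h2'))
    rw [Fin.mk.injEq] at this
    omega
  · have := Nat.eq_of_beq_eq_true (List.all_eq_true.1 h x (by clear * -; revert x; decide))
    have z : (0 : ℕ) = ((0 : Fin 8) : ℕ) := rfl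
    rw [hl, getD_table, getD_table, getD_table] at this
    apply Fin.ext
    rw [this]
    have g1 := getD_table (F 1) 0
    have g2 := getD_table (F 1) (F 1 0)
    have g3 := getD_table (F 1) (F 1 (F 1 0))
    rw [← g3, ← g2, ← g1]
    rfl

theorem main [Fintype X] [DecidableEq X] (hc : Fintype.card X = 8) (hd : Deg f) (N : ℕ)
    (hN : ∀ x y, E f N x y) :
    (∀ i : Fin 2, ConjTo (f i) fA ∨ ConjTo (f i) fJ) ∧ ¬(ConjTo (f 0) fJ ∧ ConjTo (f 1) fJ) := by
  obtain ⟨x0, y0, hxy⟩ := Fintype.one_lt_card_iff.1 (show 1 < Fintype.card X by omega)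
  have hdis := disj hd N hN x0 y0 hxy
  have hdis' : ∀ i j a b, f i a = f j b → i = j := by
    intro i j a b h
    fin_cases i <;> fin_cases j
    · rfl
    · exact absurd h (hdis a b)
    · exact absurd h.symm (hdis b a)
    · rfl
  constructor
  · intro i
    apply tree_class hc (f i) N
    · have : ∀ n x y, E f n x y → (f i)^[n] x = (f i)^[n] y := by
        intro n
        induction n with
        | zero => intro x y h; exact h
        | succ n ih => intro x y h; exact ih _ _ (h i)
      exact fun x y => this N x y (hN x y)
    · intro z
      obtain ⟨⟨i1, a⟩, ⟨i2, b⟩, hpq, h⟩ := hd (f i z)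
      have ha := (h i1 a).2 (Or.inl rfl)
      have hb := (h i2 b).2 (Or.inr rfl)
      obtain rfl := hdis' _ _ _ _ ha
      obtain rfl := hdis' _ _ _ _ hb
      refine ⟨a, b, fun hab => hpq (by rw [hab]), fun x => ?_⟩
      simpa using h i2 x
  · rintro ⟨⟨e, he⟩, ⟨e', he'⟩⟩
    let F : Fin 2 → Fin 8 → Fin 8 := fun i k => e (f i (e.symm k))
    have hrun : ∀ w k, run F w k = e (run f w (e.symm k)) := by
      intro w
      induction w with
      | nil => intro k; simp [run]
      | cons i w ih => intro k; simp [run, ih, F]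
    have hcube := cube_const F (by ext k; simp [F, he]) (by
        intro w hw x y hx hy
        rw [hrun] at hx hy
        have := fix_unique N w hw (e.symm x) (e.symm y) (hN _ _)
          (by rw [Equiv.eq_symm_apply, hx]) (by rw [Equiv.eq_symm_apply, hy])
        exact e.symm.injective this) (by
        intro a b h
        exact hdis _ _ (e.injective h)) (by
        intro b
        obtain ⟨p, q, hpq, h⟩ := hd (e.symm b)
        refine ⟨(p.1, e p.2), (q.1, e q.2), ?_, ?_⟩
        · intro h; apply hpq
          rw [Prod.mk.injEq] at h
          exact Prod.ext h.1 (e.injective h.2)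
        · intro i x
          have := h i (e.symm x)
          simp only [F, Prod.ext_iff] at this ⊢
          rw [← Equiv.eq_symm_apply, this, Equiv.symm_apply_eq, Equiv.symm_apply_eq])
    have hc3 : ∀ x y, f 1 (f 1 (f 1 x)) = f 1 (f 1 (f 1 y)) := by
      intro x y
      have h1 := hcube (e x)
      have h2 := hcube (e y)
      simp only [F, Equiv.symm_apply_apply] at h1 h2
      exact e.injective (h1.trans h2.symm)
    have := congrArg e' (hc3 (e'.symm 4) (e'.symm 0))
    simp only [he', Equiv.apply_symm_apply] at this
    revert this
    decide

end Stmt18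

/-- For any permutation of `W₂⁴` satisfying the diagonal condition, each of the two maps
`f₁^σ`, `f₂^σ` is conjugate to `fA` or `fJ`, and not both are conjugate to `fJ`. -/
theorem stmt_18 (σ : Equiv.Perm (Fin (3 + 1) → Fin 2)) (hσ : diagCond σ) :
    (∀ i : Fin 2, ConjTo (fword σ i) fA ∨ ConjTo (fword σ i) fJ) ∧
    ¬(ConjTo (fword σ 0) fJ ∧ ConjTo (fword σ 1) fJ) := by
  have hex : ∀ p : (Fin 3 → Fin 2) × (Fin 3 → Fin 2), ∃ m, Stmt18.E (fword σ) m p.1 p.2 := by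
    intro p
    have : p ∈ ⋃ m, SigmaSet (fword σ) m := by
      have h : (⋃ m, SigmaSet (fword σ) m) = Set.univ := hσ
      rw [h]; trivial
    obtain ⟨m, hm⟩ := Set.mem_iUnion.1 this
    exact ⟨m, Stmt18.E_of_sigma m _ _ hm⟩
  choose M hM using hex
  refine Stmt18.main (by simp) ?_ (Finset.univ.sup M) ?_
  · intro b
    have hsym : ∀ m : Fin 2, ∀ i x, σ.symm (Fin.cons i x : Fin (3 + 1) → Fin 2) = Fin.snoc b m ↔
        (i, x) = ((σ (Fin.snoc b m) : Fin (3 + 1) → Fin 2) 0, Fin.tail (σ (Fin.snoc b m))) := by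
      intro m i x
      rw [Equiv.symm_apply_eq]
      constructor
      · intro h; rw [← h]; simp
      · intro h
        rw [Prod.mk.injEq] at h
        rw [h.1, h.2, Fin.cons_self_tail]
    refine ⟨((σ (Fin.snoc b 0) : Fin (3 + 1) → Fin 2) 0, Fin.tail (σ (Fin.snoc b 0))),
      ((σ (Fin.snoc b 1) : Fin (3 + 1) → Fin 2) 0, Fin.tail (σ (Fin.snoc b 1))), ?_, ?_⟩
    · intro h
      have h1 := (hsym 0 _ _).2 rfl
      have h2 := (hsym 1 _ _).2 h
      have h3 := congrFun (h1.symm.trans h2) (Fin.last 3)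
      rw [Fin.snoc_last, Fin.snoc_last] at h3
      exact absurd h3 (by decide)
    · intro i x
      rw [← hsym, ← hsym]
      unfold fword
      constructor
      · intro h
        have h1 := Fin.snoc_init_self (σ.symm (Fin.cons i x : Fin (3 + 1) → Fin 2))
        rw [h] at h1
        generalize (σ.symm (Fin.cons i x : Fin (3 + 1) → Fin 2)) = t at h1 ⊢
        have h2 : t (Fin.last 3) = 0 ∨ t (Fin.last 3) = 1 := by
          generalize t (Fin.last 3) = s
          revert s; decide
        rcases h2 with h2 | h2
        · left; rw [← h1, h2]
        · right; rw [← h1, h2]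
      · rintro (h | h) <;> rw [h, Fin.init_snoc]
  · intro x y
    exact Stmt18.E_mono (Finset.le_sup (f := M) (Finset.mem_univ (x, y))) _ _ (hM (x, y))
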